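/- Let dim_H(𝓘_q) denote the Hausdorff dimension of the set 𝓘_q of irrationals in (0,1) all of whose continued fraction digits are at least q. Then as q → ∞, dim_H(𝓘_q) − 1/2 ~ (1/2) · (log log q)/(log q), i.e. the ratio of the two sides tends to 1. -/

import Mathlib

open Filter

/-- The Gauss map `x ↦ 1/x - ⌊1/x⌋`. -/
noncomputable def gaussMap (x : ℝ) : ℝ := 1 / x - ⌊1 / x⌋

/-- The `i`-th continued fraction digit of `x` (for `i ≥ 1`). -/
noncomputable def cfDigit (x : ℝ) (i : ℕ) : ℕ := ⌊1 / (gaussMap^[i - 1] x)⌋₊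

/-- Denominators of the convergents: `q_n = a_n q_{n-1} + q_{n-2}`, `q_{-1} = 0`, `q_0 = 1`. -/
def qRec (a : ℕ → ℕ) : ℕ → ℕ
  | 0 => 1
  | 1 => a 1
  | n + 2 => a (n + 2) * qRec a (n + 1) + qRec a n

/-- The denominator `q_n(x)` of the `n`-th convergent of `x`. -/
noncomputable def cfDenom (x : ℝ) : ℕ → ℕ := qRec (cfDigit x)

open MeasureTheory

/-- `𝓘_q`: irrationals in `(0,1)` all of whose continued fraction digits are at least `q`. -/
def Iq (q : ℕ) : Set ℝ :=
  {x : ℝ | x ∈ Set.Ioo (0 : ℝ) 1 ∧ Irrational x ∧ ∀ i, 1 ≤ i → q ≤ cfDigit x i}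

/-- The inverse branch `x ↦ 1 / (k + x)` of the Gauss map. -/
noncomputable def gaussBranch (k : ℕ) (x : ℝ) : ℝ := 1 / (k + x)

lemma gaussBranch_sub {k : ℕ} {x y : ℝ} (hk : 1 ≤ k) (hx : 0 ≤ x) (hy : 0 ≤ y) :
    gaussBranch k x - gaussBranch k y = (y - x) / ((k + x) * (k + y)) := by
  have hk' : (1 : ℝ) ≤ k := by exact_mod_cast hk
  have h1 : (k + x : ℝ) ≠ 0 := by positivity
  have h2 : (k + y : ℝ) ≠ 0 := by positivity
  unfold gaussBranch
  field_simp
  ring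

lemma abs_gaussBranch_sub {k : ℕ} {x y : ℝ} (hk : 1 ≤ k) (hx : 0 ≤ x) (hy : 0 ≤ y) :
    |gaussBranch k x - gaussBranch k y| = |x - y| / ((k + x) * (k + y)) := by
  have hk' : (1 : ℝ) ≤ k := by exact_mod_cast hk
  rw [gaussBranch_sub hk hx hy, abs_div, abs_sub_comm y x,
    abs_of_nonneg (by positivity : 0 ≤ (k + x) * (k + y))]

lemma abs_gaussBranch_sub_le {k : ℕ} {x y : ℝ} (hk : 1 ≤ k) (hx : 0 ≤ x) (hy : 0 ≤ y) :
    |gaussBranch k x - gaussBranch k y| ≤ ((k : ℝ) ^ 2)⁻¹ * |x - y| := by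
  have hk' : (1 : ℝ) ≤ k := by exact_mod_cast hk
  rw [abs_gaussBranch_sub hk hx hy, div_eq_inv_mul]
  gcongr
  nlinarith

lemma le_abs_gaussBranch_sub {k : ℕ} {x y : ℝ} (hk : 1 ≤ k) (hx : x ∈ Set.Icc (0 : ℝ) 1)
    (hy : y ∈ Set.Icc (0 : ℝ) 1) :
    |x - y| ≤ ((k : ℝ) + 1) ^ 2 * |gaussBranch k x - gaussBranch k y| := by
  have hk' : (1 : ℝ) ≤ k := by exact_mod_cast hk
  obtain ⟨hx0, hx1⟩ := hx
  obtain ⟨hy0, hy1⟩ := hy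
  rw [abs_gaussBranch_sub hk hx0 hy0, mul_div_assoc', le_div_iff₀ (by positivity), mul_comm]
  gcongr
  rw [sq]
  gcongr

lemma gaussBranch_mem_Icc {k : ℕ} {x : ℝ} (hk : 1 ≤ k) (hx : x ∈ Set.Icc (0 : ℝ) 1) :
    gaussBranch k x ∈ Set.Icc (0 : ℝ) 1 := by
  have hk' : (1 : ℝ) ≤ k := by exact_mod_cast hk
  have := hx.1
  refine ⟨by unfold gaussBranch; positivity, ?_⟩
  rw [gaussBranch, div_le_one (by positivity)]
  linarith

lemma gaussBranch_mem_Ioc {k : ℕ} {x : ℝ} (hk : 1 ≤ k) (hx : x ∈ Set.Icc (0 : ℝ) 1) :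
    gaussBranch k x ∈ Set.Ioc (0 : ℝ) (1 / k) := by
  have hk' : (1 : ℝ) ≤ k := by exact_mod_cast hk
  have := hx.1
  refine ⟨by unfold gaussBranch; positivity, ?_⟩
  unfold gaussBranch
  gcongr
  linarith

/-- Points in different branches over small arguments are uniformly separated. -/
lemma le_abs_gaussBranch_sub_of_ne {k l N : ℕ} {x y : ℝ} (hk : 1 ≤ k) (hl : 1 ≤ l) (hkl : k ≠ l)
    (hkN : k ≤ N) (hlN : l ≤ N) (hx : x ∈ Set.Icc (0 : ℝ) (1 / 2))
    (hy : y ∈ Set.Icc (0 : ℝ) (1 / 2)) :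
    1 / 2 / ((N : ℝ) + 1) ^ 2 ≤ |gaussBranch k x - gaussBranch l y| := by
  wlog h : k < l generalizing k l x y
  · rw [abs_sub_comm]
    exact this hl hk hkl.symm hlN hkN hy hx (by omega)
  have hk' : (1 : ℝ) ≤ k := by exact_mod_cast hk
  have hl' : (1 : ℝ) ≤ l := by exact_mod_cast hl
  have hkN' : (k : ℝ) ≤ N := by exact_mod_cast hkN
  have hlN' : (l : ℝ) ≤ N := by exact_mod_cast hlN
  have hlt : (k : ℝ) + 1 ≤ l := by exact_mod_cast h
  obtain ⟨hx0, hx1⟩ := hx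
  obtain ⟨hy0, hy1⟩ := hy
  have h1 : (k + x : ℝ) ≠ 0 := by positivity
  have h2 : (l + y : ℝ) ≠ 0 := by positivity
  have key : gaussBranch k x - gaussBranch l y = (l + y - (k + x)) / ((k + x) * (l + y)) := by
    unfold gaussBranch
    field_simp
  rw [key]
  refine le_trans ?_ (le_abs_self _)
  rw [sq]
  gcongr
  all_goals linarith

lemma gaussMap_eq_fract (x : ℝ) : gaussMap x = Int.fract (1 / x) := rfl

lemma cfDigit_succ (x : ℝ) {i : ℕ} (hi : 1 ≤ i) :
    cfDigit x (i + 1) = cfDigit (gaussMap x) i := by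
  obtain ⟨j, rfl⟩ := Nat.exists_eq_add_of_le' hi
  simp [cfDigit, Function.iterate_succ_apply]

lemma gaussBranch_gaussMap {x : ℝ} (hx : 0 < x) :
    gaussBranch (cfDigit x 1) (gaussMap x) = x := by
  have h : ((cfDigit x 1 : ℕ) : ℝ) = ⌊1 / x⌋ := by
    simp only [cfDigit, Nat.sub_self, Function.iterate_zero, id]
    exact natCast_floor_eq_intCast_floor (by positivity)
  rw [gaussBranch, h, gaussMap]
  simp

lemma gaussMap_mem_Iq {q : ℕ} {x : ℝ} (hx : x ∈ Iq q) : gaussMap x ∈ Iq q := by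
  obtain ⟨-, hirr, hdig⟩ := hx
  have hirr' : Irrational (gaussMap x) := by
    have : Irrational (1 / x) := by simpa using hirr.inv
    exact this.sub_intCast _
  refine ⟨⟨lt_of_le_of_ne (Int.fract_nonneg _) ?_, Int.fract_lt_one _⟩, hirr', fun i hi => ?_⟩
  · exact fun h => hirr'.ne_zero h.symm
  · rw [← cfDigit_succ x hi]
    exact hdig _ (by omega)

lemma exists_cover_Iq {q : ℕ} (hq : 2 ≤ q) {t : ℝ} (ht : 0 < t)
    (hsum : ∑' j : ℕ, ENNReal.ofReal ((((q + j : ℕ) : ℝ) ^ 2)⁻¹) ^ t ≤ 1) (n : ℕ) :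
    ∃ U : ℕ → Set ℝ, (∀ i, U i ⊆ Set.Icc 0 1) ∧ (∀ i, Metric.ediam (U i) ≤ (1 / 4) ^ n) ∧
      Iq q ⊆ ⋃ i, U i ∧ ∑' i, Metric.ediam (U i) ^ t ≤ 1 := by
  induction n with
  | zero =>
    refine ⟨fun i => if i = 0 then Set.Icc 0 1 else ∅, fun i => ?_, fun i => ?_, fun x hx => ?_, ?_⟩
    · dsimp only
      split_ifs <;> simp
    · dsimp only
      split_ifs <;> simp [Real.ediam_Icc]
    · refine Set.mem_iUnion.2 ⟨0, ?_⟩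
      simpa using ⟨hx.1.1.le, hx.1.2.le⟩
    · rw [tsum_eq_single 0]
      · simp [Real.ediam_Icc]
      · intro i hi
        simp [hi, ht]
  | succ n ih =>
    obtain ⟨U, hU, hd, hcov, hs⟩ := ih
    have hdiam (j i : ℕ) : Metric.ediam (gaussBranch (q + j) '' U i) ≤
        ENNReal.ofReal ((((q + j : ℕ) : ℝ) ^ 2)⁻¹) * Metric.ediam (U i) := by
      have hL : LipschitzOnWith (Real.toNNReal ((((q + j : ℕ) : ℝ) ^ 2)⁻¹))
          (gaussBranch (q + j)) (U i) := by
        refine LipschitzOnWith.of_dist_le_mul fun x hx y hy => ?_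
        rw [Real.coe_toNNReal _ (by positivity), Real.dist_eq, Real.dist_eq]
        exact abs_gaussBranch_sub_le (by omega) (hU i hx).1 (hU i hy).1
      simpa only [ENNReal.ofReal, NNReal.coe_one, ENNReal.rpow_one] using
        hL.holderOnWith.ediam_image_le
    let e : ℕ ≃ ℕ × ℕ := Nat.pairEquiv.symm
    refine ⟨fun m => gaussBranch (q + (e m).1) '' U (e m).2, fun m => ?_, fun m => ?_,
      fun x hx => ?_, ?_⟩
    · rintro _ ⟨x, hx, rfl⟩
      exact gaussBranch_mem_Icc (by omega) (hU _ hx)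
    · refine (hdiam _ _).trans ?_
      rw [pow_succ' _ n]
      refine mul_le_mul' ?_ (hd _)
      have : (1 / 4 : ENNReal) = ENNReal.ofReal (1 / 4) := by
        rw [ENNReal.ofReal_div_of_pos (by norm_num)]; norm_num
      rw [this]
      refine ENNReal.ofReal_le_ofReal ?_
      have h2 : (2 : ℝ) ≤ ((q + (e m).1 : ℕ) : ℝ) := by exact_mod_cast (by omega)
      rw [one_div]
      gcongr
      nlinarith
    · have hk : q ≤ cfDigit x 1 := hx.2.2 1 le_rfl
      obtain ⟨i, hi⟩ := Set.mem_iUnion.1 (hcov (gaussMap_mem_Iq hx))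
      refine Set.mem_iUnion.2 ⟨e.symm (cfDigit x 1 - q, i), gaussMap x, ?_, ?_⟩
      · simpa using hi
      · simp only [Equiv.apply_symm_apply, Nat.add_sub_cancel' hk]
        exact gaussBranch_gaussMap hx.1.1
    · calc ∑' m, Metric.ediam (gaussBranch (q + (e m).1) '' U (e m).2) ^ t
          = ∑' p : ℕ × ℕ, Metric.ediam (gaussBranch (q + p.1) '' U p.2) ^ t :=
            e.tsum_eq fun p : ℕ × ℕ => Metric.ediam (gaussBranch (q + p.1) '' U p.2) ^ t
        _ = ∑' (j : ℕ) (i : ℕ), Metric.ediam (gaussBranch (q + j) '' U i) ^ t :=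
            ENNReal.tsum_prod (f := fun j i => Metric.ediam (gaussBranch (q + j) '' U i) ^ t)
        _ ≤ ∑' (j : ℕ) (i : ℕ), ENNReal.ofReal ((((q + j : ℕ) : ℝ) ^ 2)⁻¹) ^ t *
              Metric.ediam (U i) ^ t := by
            gcongr with j i
            rw [← ENNReal.mul_rpow_of_nonneg _ _ ht.le]
            exact ENNReal.rpow_le_rpow (hdiam j i) ht.le
        _ = (∑' j : ℕ, ENNReal.ofReal ((((q + j : ℕ) : ℝ) ^ 2)⁻¹) ^ t) *
              ∑' i, Metric.ediam (U i) ^ t := by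
            simp_rw [ENNReal.tsum_mul_left, ENNReal.tsum_mul_right]
        _ ≤ 1 := mul_le_one' hsum hs

/-- Bowen-type upper bound: the exponent `t` bounds the dimension of `Iq q` as soon as the
derivative sums over the branches are at most `1`. -/
lemma dimH_Iq_le {q : ℕ} (hq : 2 ≤ q) {t : ℝ} (ht : 0 < t)
    (hsum : ∀ n, ∑ j ∈ Finset.range n, ((q : ℝ) + j) ^ (-(2 * t)) ≤ 1) :
    dimH (Iq q) ≤ ENNReal.ofReal t := by
  have hsum' : ∑' j : ℕ, ENNReal.ofReal ((((q + j : ℕ) : ℝ) ^ 2)⁻¹) ^ t ≤ 1 := by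
    refine ENNReal.tsum_le_of_sum_range_le fun n => ?_
    have : ∀ j : ℕ, ENNReal.ofReal ((((q + j : ℕ) : ℝ) ^ 2)⁻¹) ^ t =
        ENNReal.ofReal (((q : ℝ) + j) ^ (-(2 * t))) := fun j => by
      have h0 : (0 : ℝ) < q + j := by positivity
      rw [ENNReal.ofReal_rpow_of_nonneg (by positivity) ht.le]
      push_cast
      rw [Real.inv_rpow (by positivity), Real.rpow_neg h0.le, ← Real.rpow_natCast,
        ← Real.rpow_mul h0.le]
      norm_num
    simp_rw [this]
    rw [← ENNReal.ofReal_sum_of_nonneg (fun j _ => by positivity)]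
    exact ENNReal.ofReal_le_one.2 (hsum n)
  choose U _ hd hcov hs using exists_cover_Iq hq ht hsum'
  have hμ : μH[t] (Iq q) ≤ 1 := by
    refine (Measure.hausdorffMeasure_le_liminf_tsum (l := atTop) t (Iq q)
      (fun n : ℕ => (1 / 4 : ENNReal) ^ n) ?_ U (Eventually.of_forall hd)
      (Eventually.of_forall hcov)).trans ?_
    · exact ENNReal.tendsto_pow_atTop_nhds_zero_of_lt_one (by norm_num)
    · exact (liminf_le_liminf (Eventually.of_forall hs)).trans (by simp)
  have : μH[(t.toNNReal : ℝ)] (Iq q) ≠ ⊤ := by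
    rw [Real.coe_toNNReal _ ht.le]
    exact ne_top_of_le_ne_top ENNReal.one_ne_top hμ
  exact dimH_le_of_hausdorffMeasure_ne_top this

/-- Images of `[0, 1]` under the first `n` branches prescribed by the digit sequence `a`. -/
def cfCylinder : ℕ → (ℕ → ℕ) → Set ℝ
  | 0, _ => Set.Icc 0 1
  | n + 1, a => gaussBranch (a 0) '' cfCylinder n fun i => a (i + 1)

/-- The points whose continued fraction expansion is prescribed by the digit sequence `a`. -/
def cfLimit (a : ℕ → ℕ) : Set ℝ := ⋂ n, cfCylinder n a

lemma cfCylinder_succ_subset {a : ℕ → ℕ} (ha : ∀ i, 1 ≤ a i) (n : ℕ) :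
    cfCylinder (n + 1) a ⊆ cfCylinder n a := by
  induction n generalizing a with
  | zero =>
    rintro _ ⟨x, hx, rfl⟩
    exact gaussBranch_mem_Icc (ha 0) hx
  | succ n ih => exact Set.image_mono (ih fun i => ha (i + 1))

lemma cfCylinder_subset_Icc {a : ℕ → ℕ} (ha : ∀ i, 1 ≤ a i) (n : ℕ) :
    cfCylinder n a ⊆ Set.Icc 0 1 :=
  antitone_nat_of_succ_le (f := fun n => cfCylinder n a) (cfCylinder_succ_subset ha) n.zero_le

lemma continuousOn_gaussBranch {k : ℕ} (hk : 1 ≤ k) :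
    ContinuousOn (gaussBranch k) (Set.Icc 0 1) := by
  have hk' : (1 : ℝ) ≤ k := by exact_mod_cast hk
  unfold gaussBranch
  refine continuousOn_const.div (by fun_prop) fun x hx => ?_
  have := hx.1
  positivity

lemma isCompact_cfCylinder {a : ℕ → ℕ} (ha : ∀ i, 1 ≤ a i) (n : ℕ) :
    IsCompact (cfCylinder n a) := by
  induction n generalizing a with
  | zero => exact isCompact_Icc
  | succ n ih =>
    have ha' : ∀ i, 1 ≤ a (i + 1) := fun i => ha _
    exact (ih ha').image_of_continuousOn
      ((continuousOn_gaussBranch (ha 0)).mono (cfCylinder_subset_Icc ha' n))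

lemma cfCylinder_nonempty (n : ℕ) (a : ℕ → ℕ) : (cfCylinder n a).Nonempty := by
  induction n generalizing a with
  | zero => exact ⟨0, by simp [cfCylinder]⟩
  | succ n ih => exact (ih _).image _

lemma cfLimit_nonempty {a : ℕ → ℕ} (ha : ∀ i, 1 ≤ a i) : (cfLimit a).Nonempty :=
  IsCompact.nonempty_iInter_of_sequence_nonempty_isCompact_isClosed _
    (cfCylinder_succ_subset ha) (fun n => cfCylinder_nonempty n a) (isCompact_cfCylinder ha 0)
    fun n => (isCompact_cfCylinder ha n).isClosed

lemma exists_gaussBranch_eq_of_mem_cfLimit {a : ℕ → ℕ} (ha : ∀ i, 1 ≤ a i) {x : ℝ}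
    (hx : x ∈ cfLimit a) : ∃ y ∈ cfLimit (fun i => a (i + 1)), gaussBranch (a 0) y = x := by
  have hx' := Set.mem_iInter.1 hx
  have ha' : ∀ i, 1 ≤ a (i + 1) := fun i => ha _
  obtain ⟨y, hy, rfl⟩ := hx' 1
  refine ⟨y, Set.mem_iInter.2 fun n => ?_, rfl⟩
  obtain ⟨z, hz, hzy⟩ := hx' (n + 1)
  have hle := le_abs_gaussBranch_sub (ha 0) (cfCylinder_subset_Icc ha' n hz) hy
  rw [hzy, sub_self, abs_zero, mul_zero] at hle
  rwa [← sub_eq_zero.1 (abs_nonpos_iff.1 hle)]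

lemma mem_Ioc_of_mem_cfLimit {a : ℕ → ℕ} (ha : ∀ i, 2 ≤ a i) {x : ℝ} (hx : x ∈ cfLimit a) :
    x ∈ Set.Ioc (0 : ℝ) (1 / 2) := by
  have ha' : ∀ i, 1 ≤ a i := fun i => le_trans (by norm_num) (ha i)
  obtain ⟨y, hy, rfl⟩ := exists_gaussBranch_eq_of_mem_cfLimit ha' hx
  have h := gaussBranch_mem_Ioc (ha' 0) (Set.mem_iInter.1 hy 0)
  refine ⟨h.1, h.2.trans ?_⟩
  have : (2 : ℝ) ≤ a 0 := by exact_mod_cast ha 0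
  gcongr

lemma gaussMap_mem_cfLimit {a : ℕ → ℕ} (ha : ∀ i, 2 ≤ a i) {x : ℝ} (hx : x ∈ cfLimit a) :
    gaussMap x ∈ cfLimit (fun i => a (i + 1)) ∧ ⌊1 / x⌋₊ = a 0 ∧
      gaussBranch (a 0) (gaussMap x) = x := by
  obtain ⟨y, hy, rfl⟩ :=
    exists_gaussBranch_eq_of_mem_cfLimit (fun i => le_trans (by norm_num) (ha i)) hx
  obtain ⟨hy0, hy1⟩ := mem_Ioc_of_mem_cfLimit (fun i => ha (i + 1)) hy
  have hinv : 1 / gaussBranch (a 0) y = y + (a 0 : ℕ) := by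
    simp [gaussBranch, add_comm]
  have hg : gaussMap (gaussBranch (a 0) y) = y := by
    rw [gaussMap_eq_fract, hinv, Int.fract_add_natCast, Int.fract_eq_self]
    exact ⟨hy0.le, by linarith⟩
  refine ⟨by rwa [hg], ?_, by rw [hg]⟩
  rw [hinv, Nat.floor_add_natCast hy0.le, Nat.floor_eq_zero.2 (by linarith), zero_add]

lemma iterate_gaussMap_mem_cfLimit {a : ℕ → ℕ} (ha : ∀ i, 2 ≤ a i) {x : ℝ} (hx : x ∈ cfLimit a)
    (n : ℕ) : gaussMap^[n] x ∈ cfLimit fun i => a (i + n) := by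
  induction n with
  | zero => exact hx
  | succ n ih =>
    rw [Function.iterate_succ_apply']
    have := (gaussMap_mem_cfLimit (fun i => ha (i + n)) ih).1
    simpa only [add_right_comm _ 1 n, add_assoc] using this

lemma irrational_of_mem_cfLimit {a : ℕ → ℕ} (ha : ∀ i, 2 ≤ a i) {x : ℝ} (hx : x ∈ cfLimit a) :
    Irrational x := by
  have key : ∀ d m : ℕ, ∀ (a : ℕ → ℕ), (∀ i, 2 ≤ a i) → ∀ x ∈ cfLimit a, x * d = m → d = 0 := by
    intro d
    induction d using Nat.strong_induction_on with
    | _ d ih =>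
      intro m a ha x hx h
      by_contra hd
      have hd' : (0 : ℝ) < d := by exact_mod_cast Nat.pos_of_ne_zero hd
      obtain ⟨hx0, hx1⟩ := mem_Ioc_of_mem_cfLimit ha hx
      obtain ⟨hg, -, hb⟩ := gaussMap_mem_cfLimit ha hx
      have hg0 := (mem_Ioc_of_mem_cfLimit (fun i => ha (i + 1)) hg).1
      have hm0 : (0 : ℝ) < m := h ▸ mul_pos hx0 hd'
      have hmd : m < d := by
        have : (m : ℝ) < d := by rw [← h]; nlinarith
        exact_mod_cast this
      have hmul : gaussMap x * m = d - a 0 * m := by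
        have : x * (a 0 + gaussMap x) = 1 := by
          nth_rw 1 [← hb]
          rw [gaussBranch, one_div, inv_mul_cancel₀ (by positivity)]
        rw [← h]
        linear_combination d * this
      have hle : a 0 * m ≤ d := by
        have : (a 0 : ℝ) * m ≤ d := by nlinarith [mul_pos hg0 hm0]
        exact_mod_cast this
      have := ih m hmd (d - a 0 * m) _ (fun i => ha (i + 1)) _ hg (by
        rw [hmul, Nat.cast_sub hle]; push_cast; rfl)
      simp [this] at hm0
  rintro ⟨r, rfl⟩
  have hpos : (0 : ℚ) < r := by exact_mod_cast (mem_Ioc_of_mem_cfLimit ha hx).1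
  refine r.den_nz (key r.den r.num.toNat a ha _ hx ?_)
  have : ((r.num.toNat : ℤ) : ℚ) = r.num := by
    rw [Int.toNat_of_nonneg (Rat.num_nonneg.2 hpos.le)]
  have h2 : r * r.den = ((r.num.toNat : ℕ) : ℚ) := by
    rw [Rat.mul_den_eq_num, ← this]; rfl
  exact_mod_cast h2

lemma cfLimit_subset_Iq {q : ℕ} (hq : 2 ≤ q) {a : ℕ → ℕ} (ha : ∀ i, q ≤ a i) :
    cfLimit a ⊆ Iq q := by
  intro x hx
  have ha' : ∀ i, 2 ≤ a i := fun i => hq.trans (ha i)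
  obtain ⟨h0, h1⟩ := mem_Ioc_of_mem_cfLimit ha' hx
  refine ⟨⟨h0, by linarith⟩, irrational_of_mem_cfLimit ha' hx, fun i _ => ?_⟩
  have := (gaussMap_mem_cfLimit (fun j => ha' (j + (i - 1)))
    (iterate_gaussMap_mem_cfLimit ha' hx (i - 1))).2.1
  rw [cfDigit, this]
  exact ha _

/-- A step of the expansion of `y ∈ [0, 1)` in the intervals with lengths `p q, p (q + 1), …`. -/
lemma exists_interval_expansion_step {p : ℕ → ℝ} {q N : ℕ} (hp : ∀ k, 0 < p k)
    (hsum : ∑ k ∈ Finset.Ico q N, p k = 1) {y : ℝ} (hy : y ∈ Set.Ico (0 : ℝ) 1) :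
    ∃ k : ℕ, ∃ z ∈ Set.Ico (0 : ℝ) 1, q ≤ k ∧ k ≤ N ∧
      y = ∑ j ∈ Finset.Ico q k, p j + p k * z := by
  classical
  have hex : ∃ k, y < ∑ j ∈ Finset.Ico q (k + 1), p j := by
    refine ⟨N, hy.2.trans_le ?_⟩
    rw [← hsum]
    exact Finset.sum_le_sum_of_subset_of_nonneg (Finset.Ico_subset_Ico_right (by omega))
      fun i _ _ => (hp i).le
  have hspec := Nat.find_spec hex
  set k := Nat.find hex with hk
  have hqk : q ≤ k := by
    by_contra! h
    rw [Finset.Ico_eq_empty_of_le (by omega), Finset.sum_empty] at hspec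
    exact hspec.not_ge hy.1
  have hlow : ∑ j ∈ Finset.Ico q k, p j ≤ y := by
    rcases hqk.eq_or_lt with h | h
    · rw [← h]; simpa using hy.1
    · have := Nat.find_min hex (m := k - 1) (by omega)
      rwa [not_lt, Nat.sub_add_cancel (by omega)] at this
  have hkN : k ≤ N := Nat.find_le (by
    refine hy.2.trans_le ?_
    rw [← hsum]
    exact Finset.sum_le_sum_of_subset_of_nonneg (Finset.Ico_subset_Ico_right (by omega))
      fun i _ _ => (hp i).le)
  rw [Finset.sum_Ico_succ_top hqk] at hspec
  refine ⟨k, (y - ∑ j ∈ Finset.Ico q k, p j) / p k, ⟨?_, ?_⟩, hqk, hkN, ?_⟩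
  · exact div_nonneg (by linarith) (hp k).le
  · rw [div_lt_one (hp k)]; linarith
  · field_simp [(hp k).ne']
    ring

/-- Bowen-type lower bound: the exponent `t` is at most the dimension of `Iq q` as soon as the
derivative sums over finitely many branches reach `1`. -/
lemma le_dimH_Iq {q N : ℕ} (hq : 2 ≤ q) {t : ℝ} (ht : 1 / 2 ≤ t)
    (hsum : 1 ≤ ∑ k ∈ Finset.Ico q N, ((k : ℝ) + 1) ^ (-(2 * t))) :
    ENNReal.ofReal t ≤ dimH (Iq q) := by
  have ht0 : 0 < t := by linarith
  set Z := ∑ k ∈ Finset.Ico q N, ((k : ℝ) + 1) ^ (-(2 * t)) with hZ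
  set p : ℕ → ℝ := fun k => ((k : ℝ) + 1) ^ (-(2 * t)) / Z with hp
  have hZ0 : 0 < Z := by linarith
  have hp0 (k : ℕ) : 0 < p k := by simp only [hp]; positivity
  have hpt (k : ℕ) : p k * (((k : ℝ) + 1) ^ 2) ^ t ≤ 1 := by
    have h : (((k : ℝ) + 1) ^ 2) ^ t = ((k : ℝ) + 1) ^ (2 * t) := by
      rw [← Real.rpow_natCast, ← Real.rpow_mul (by positivity)]; norm_num
    rw [h, hp, div_mul_eq_mul_div, ← Real.rpow_add (by positivity), neg_add_cancel,
      Real.rpow_zero, div_le_one hZ0]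
    exact hsum
  have hphalf {k : ℕ} (hk : q ≤ k) : p k ≤ 1 / 2 := by
    have hk1 : (2 : ℝ) ≤ (k : ℝ) + 1 := by
      have : (2 : ℝ) ≤ k := by exact_mod_cast hq.trans hk
      linarith
    calc p k ≤ ((k : ℝ) + 1) ^ (-(2 * t)) := div_le_self (by positivity) hsum
      _ ≤ ((k : ℝ) + 1) ^ (-1 : ℝ) :=
        Real.rpow_le_rpow_of_exponent_le (by linarith) (by linarith)
      _ = ((k : ℝ) + 1)⁻¹ := Real.rpow_neg_one _
      _ ≤ 1 / 2 := by rw [one_div]; gcongr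
  have hp1 : ∑ k ∈ Finset.Ico q N, p k = 1 := by
    rw [← Finset.sum_div, div_self hZ0.ne']
  choose! κ D hD hqκ hκN hexp using
    fun (y : ℝ) (hy : y ∈ Set.Ico (0 : ℝ) 1) => exists_interval_expansion_step hp0 hp1 hy
  let digits : ℝ → ℕ → ℕ := fun y i => κ (D^[i] y)
  have hDi {y : ℝ} (hy : y ∈ Set.Ico (0 : ℝ) 1) (i : ℕ) : D^[i] y ∈ Set.Ico (0 : ℝ) 1 := by
    induction i with
    | zero => exact hy
    | succ i ih => rw [Function.iterate_succ_apply']; exact hD _ ih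
  have hdig {y : ℝ} (hy : y ∈ Set.Ico (0 : ℝ) 1) (i : ℕ) : q ≤ digits y i := hqκ _ (hDi hy i)
  set g : ℝ := 1 / 2 / ((N : ℝ) + 1) ^ 2 with hg
  have hg0 : 0 < g := by positivity
  have key (n : ℕ) : ∀ y ∈ Set.Ico (0 : ℝ) 1, ∀ y' ∈ Set.Ico (0 : ℝ) 1,
      ∀ x ∈ cfLimit (digits y), ∀ x' ∈ cfLimit (digits y'),
      |y - y'| ≤ (|x - x'| / g) ^ t + (1 / 2) ^ n := by
    induction n with
    | zero =>
      intro y hy y' hy' x _ x' _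
      have : |y - y'| ≤ 1 := by
        rw [abs_le]; constructor <;> linarith [hy.1, hy.2, hy'.1, hy'.2]
      have : 0 ≤ (|x - x'| / g) ^ t := by positivity
      rw [pow_zero]
      linarith
    | succ n ih =>
      intro y hy y' hy' x hx x' hx'
      have h2 (i : ℕ) : 2 ≤ digits y i := hq.trans (hdig hy i)
      have h2' (i : ℕ) : 2 ≤ digits y' i := hq.trans (hdig hy' i)
      obtain ⟨hgx, -, hbx⟩ := gaussMap_mem_cfLimit h2 hx
      obtain ⟨hgx', -, hbx'⟩ := gaussMap_mem_cfLimit h2' hx'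
      have hI := mem_Ioc_of_mem_cfLimit (fun i => h2 (i + 1)) hgx
      have hI' := mem_Ioc_of_mem_cfLimit (fun i => h2' (i + 1)) hgx'
      have hb0 : digits y 0 = κ y := rfl
      have hb0' : digits y' 0 = κ y' := rfl
      by_cases hκ : κ y = κ y'
      · have hrec := ih (D y) (hD y hy) (D y') (hD y' hy') _ hgx _ hgx'
        have hyy : |y - y'| = p (κ y) * |D y - D y'| := by
          conv_lhs => rw [hexp y hy, hexp y' hy', ← hκ, add_sub_add_left_eq_sub, ← mul_sub,
            abs_mul, abs_of_pos (hp0 _)]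
        have hle : |gaussMap x - gaussMap x'| ≤ ((κ y : ℝ) + 1) ^ 2 * |x - x'| := by
          conv_rhs => rw [← hbx, ← hbx', hb0, hb0', ← hκ]
          exact le_abs_gaussBranch_sub (le_trans (by norm_num) (h2 0))
            ⟨hI.1.le, by linarith [hI.2]⟩ ⟨hI'.1.le, by linarith [hI'.2]⟩
        calc |y - y'| = p (κ y) * |D y - D y'| := hyy
          _ ≤ p (κ y) * ((((κ y : ℝ) + 1) ^ 2 * |x - x'| / g) ^ t + (1 / 2) ^ n) := by
            refine mul_le_mul_of_nonneg_left (hrec.trans ?_) (hp0 _).le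
            gcongr
          _ = p (κ y) * (((κ y : ℝ) + 1) ^ 2) ^ t * (|x - x'| / g) ^ t +
                p (κ y) * (1 / 2) ^ n := by
            rw [mul_div_assoc, Real.mul_rpow (by positivity) (by positivity)]
            ring
          _ ≤ 1 * (|x - x'| / g) ^ t + 1 / 2 * (1 / 2) ^ n := by
            gcongr
            · exact hpt _
            · exact hphalf (hqκ y hy)
          _ = (|x - x'| / g) ^ t + (1 / 2) ^ (n + 1) := by rw [one_mul, pow_succ']
      · have hsep : g ≤ |x - x'| := by
          rw [← hbx, ← hbx']
          exact le_abs_gaussBranch_sub_of_ne (le_trans (by norm_num) (h2 0))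
            (le_trans (by norm_num) (h2' 0)) hκ (hκN y hy) (hκN y' hy')
            ⟨hI.1.le, hI.2⟩ ⟨hI'.1.le, hI'.2⟩
        have h1 : 1 ≤ (|x - x'| / g) ^ t :=
          Real.one_le_rpow ((one_le_div hg0).2 hsep) ht0.le
        have : |y - y'| ≤ 1 := by
          rw [abs_le]; constructor <;> linarith [hy.1, hy.2, hy'.1, hy'.2]
        have : (0 : ℝ) ≤ (1 / 2) ^ (n + 1) := by positivity
        linarith
  have holder : ∀ y ∈ Set.Ico (0 : ℝ) 1, ∀ y' ∈ Set.Ico (0 : ℝ) 1,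
      ∀ x ∈ cfLimit (digits y), ∀ x' ∈ cfLimit (digits y'),
      |y - y'| ≤ (|x - x'| / g) ^ t := by
    intro y hy y' hy' x hx x' hx'
    have hlim : Tendsto (fun n : ℕ => (|x - x'| / g) ^ t + (1 / 2 : ℝ) ^ n) atTop
        (nhds ((|x - x'| / g) ^ t + 0)) :=
      tendsto_const_nhds.add (tendsto_pow_atTop_nhds_zero_of_lt_one (by norm_num) (by norm_num))
    rw [add_zero] at hlim
    exact ge_of_tendsto' hlim fun n => key n y hy y' hy' x hx x' hx'
  set A : Set ℝ := {x | ∃ y ∈ Set.Ico (0 : ℝ) 1, x ∈ cfLimit (digits y)} with hA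
  have hAI : A ⊆ Iq q := fun x ⟨y, hy, hx⟩ => cfLimit_subset_Iq hq (hdig hy) hx
  choose! φ hφ hφx using fun (x : ℝ) (hx : x ∈ A) => hx
  have hHolder : HolderOnWith (Real.toNNReal ((1 / g) ^ t)) (Real.toNNReal t) φ A := by
    intro x hx x' hx'
    have h := holder _ (hφ x hx) _ (hφ x' hx') _ (hφx x hx) _ (hφx x' hx')
    rw [div_eq_inv_mul, Real.mul_rpow (by positivity) (by positivity), ← one_div] at h
    rw [edist_dist, edist_dist, Real.dist_eq, Real.dist_eq, Real.coe_toNNReal _ ht0.le,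
      ENNReal.ofReal_rpow_of_nonneg (abs_nonneg _) ht0.le]
    change _ ≤ ENNReal.ofReal _ * _
    rw [← ENNReal.ofReal_mul (by positivity)]
    exact ENNReal.ofReal_le_ofReal h
  have himage : Set.Ico (0 : ℝ) 1 ⊆ φ '' A := by
    intro y hy
    obtain ⟨x, hx⟩ := cfLimit_nonempty
      (fun i => le_trans (by omega : 1 ≤ q) (hdig hy i))
    have hxA : x ∈ A := ⟨y, hy, hx⟩
    refine ⟨x, hxA, ?_⟩
    have h := holder _ (hφ x hxA) _ hy _ (hφx x hxA) _ hx
    rw [sub_self, abs_zero, zero_div, Real.zero_rpow ht0.ne'] at h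
    exact sub_eq_zero.1 (abs_nonpos_iff.1 h)
  have hdim : (1 : ENNReal) ≤ dimH A / ENNReal.ofReal t := by
    calc (1 : ENNReal) = dimH (Set.Ico (0 : ℝ) 1) := by
          rw [Real.dimH_of_nonempty_interior]
          · simp
          · simp
      _ ≤ dimH (φ '' A) := dimH_mono himage
      _ ≤ _ := hHolder.dimH_image_le (Real.toNNReal_pos.2 ht0)
  rw [ENNReal.le_div_iff_mul_le (by simp [ht0]) (by simp), one_mul] at hdim
  exact hdim.trans (dimH_mono hAI)

lemma exists_rpow_neg_sub_eq {x s : ℝ} (hx : 0 < x) :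
    ∃ c ∈ Set.Ioo x (x + 1), x ^ (-s) - (x + 1) ^ (-s) = s * c ^ (-(1 + s)) := by
  have hne {c : ℝ} (hc : x ≤ c) : c ≠ 0 := (hx.trans_le hc).ne'
  obtain ⟨c, hc, h⟩ := exists_hasDerivAt_eq_slope (fun y : ℝ => y ^ (-s))
    (fun y : ℝ => -s * y ^ (-s - 1)) (lt_add_one x)
    (fun y hy => (Real.continuousAt_rpow_const _ _ (Or.inl (hne hy.1))).continuousWithinAt)
    (fun y hy => Real.hasDerivAt_rpow_const (Or.inl (hne hy.1.le)))
  refine ⟨c, hc, ?_⟩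
  rw [add_sub_cancel_left, div_one] at h
  rw [show -(1 + s) = -s - 1 by ring]
  linarith

lemma mul_rpow_neg_le_sub {x s : ℝ} (hx : 0 < x) (hs : 0 < s) :
    s * (x + 1) ^ (-(1 + s)) ≤ x ^ (-s) - (x + 1) ^ (-s) := by
  obtain ⟨c, hc, h⟩ := exists_rpow_neg_sub_eq (s := s) hx
  rw [h]
  exact mul_le_mul_of_nonneg_left
    (Real.rpow_le_rpow_of_nonpos (hx.trans hc.1) hc.2.le (by linarith)) hs.le

lemma sub_le_mul_rpow_neg {x s : ℝ} (hx : 0 < x) (hs : 0 < s) :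
    x ^ (-s) - (x + 1) ^ (-s) ≤ s * x ^ (-(1 + s)) := by
  obtain ⟨c, hc, h⟩ := exists_rpow_neg_sub_eq (s := s) hx
  rw [h]
  exact mul_le_mul_of_nonneg_left
    (Real.rpow_le_rpow_of_nonpos hx hc.1.le (by linarith)) hs.le

lemma dimH_Iq_le_of_rpow_le {q : ℕ} (hq : 2 ≤ q) {s : ℝ} (hs : 0 < s)
    (h : ((q : ℝ) - 1) ^ (-s) ≤ s) : dimH (Iq q) ≤ ENNReal.ofReal ((1 + s) / 2) := by
  have hq' : (2 : ℝ) ≤ q := by exact_mod_cast hq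
  refine dimH_Iq_le hq (by linarith) fun n => ?_
  have htel : s * ∑ j ∈ Finset.range n, ((q : ℝ) + j) ^ (-(1 + s)) ≤
      ((q : ℝ) - 1) ^ (-s) - ((q : ℝ) - 1 + n) ^ (-s) := by
    induction n with
    | zero => simp
    | succ n ih =>
      have := mul_rpow_neg_le_sub (x := (q : ℝ) - 1 + n) (by have := n.cast_nonneg (α := ℝ); linarith) hs
      rw [show (q : ℝ) - 1 + n + 1 = q + n by ring] at this
      rw [Finset.sum_range_succ, mul_add]
      push_cast
      rw [show (q : ℝ) - 1 + (n + 1) = q + n by ring]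
      linarith
  rw [mul_div_cancel₀ _ (two_ne_zero)]
  have hpos : 0 ≤ ((q : ℝ) - 1 + n) ^ (-s) :=
    Real.rpow_nonneg (by have := n.cast_nonneg (α := ℝ); linarith) _
  exact le_of_mul_le_mul_left (by linarith) hs

lemma le_dimH_Iq_of_lt_rpow {q : ℕ} (hq : 2 ≤ q) {s : ℝ} (hs : 0 < s)
    (h : s < ((q : ℝ) + 1) ^ (-s)) : ENNReal.ofReal ((1 + s) / 2) ≤ dimH (Iq q) := by
  have htel (n : ℕ) : ((q : ℝ) + 1) ^ (-s) - ((q : ℝ) + 1 + n) ^ (-s) ≤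
      s * ∑ k ∈ Finset.Ico q (q + n), ((k : ℝ) + 1) ^ (-(1 + s)) := by
    induction n with
    | zero => simp
    | succ n ih =>
      have := sub_le_mul_rpow_neg (x := (q : ℝ) + 1 + n) (by positivity) hs
      rw [← add_assoc, Finset.sum_Ico_succ_top (by omega), mul_add]
      push_cast
      rw [show (q : ℝ) + n + 1 = q + 1 + n by ring, ← add_assoc]
      linarith
  have hlim : Tendsto (fun n : ℕ => ((q : ℝ) + 1) ^ (-s) - ((q : ℝ) + 1 + n) ^ (-s)) atTop
      (nhds (((q : ℝ) + 1) ^ (-s) - 0)) :=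
    tendsto_const_nhds.sub ((tendsto_rpow_neg_atTop hs).comp
      (tendsto_atTop_add_const_left _ _ tendsto_natCast_atTop_atTop))
  rw [sub_zero] at hlim
  obtain ⟨n, hn⟩ := (hlim.eventually (lt_mem_nhds h)).exists
  refine le_dimH_Iq (N := q + n) hq (by linarith) ?_
  rw [mul_div_cancel₀ _ (two_ne_zero)]
  exact le_of_mul_le_mul_left (by linarith [htel n]) hs

lemma tendsto_log_natCast : Tendsto (fun q : ℕ => Real.log q) atTop atTop :=
  Real.tendsto_log_atTop.comp tendsto_natCast_atTop_atTop

lemma tendsto_log_log_natCast : Tendsto (fun q : ℕ => Real.log (Real.log q)) atTop atTop :=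
  Real.tendsto_log_atTop.comp tendsto_log_natCast

lemma log_mul_div_eq {c L : ℝ} (hc : 0 < c) (hL : 0 < L) (hl : 0 < Real.log L) :
    Real.log (c * (Real.log L / L)) = Real.log c + Real.log (Real.log L) - Real.log L := by
  rw [Real.log_mul hc.ne' (by positivity), Real.log_div hl.ne' hL.ne']
  ring

lemma eventually_dimH_Iq_le {c : ℝ} (hc : 1 < c) : ∀ᶠ q : ℕ in atTop,
    dimH (Iq q) ≤ ENNReal.ofReal ((1 + c * (Real.log (Real.log q) / Real.log q)) / 2) := by
  have hlog2 := Real.log_pos one_lt_two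
  filter_upwards [eventually_ge_atTop 2, tendsto_log_natCast.eventually_ge_atTop 1,
    tendsto_log_natCast.eventually_ge_atTop (c * Real.log 2 / (c - 1)),
    tendsto_log_log_natCast.eventually_ge_atTop 1] with q hq hL hLc hl
  have hq' : (2 : ℝ) ≤ q := by exact_mod_cast hq
  set L := Real.log q
  have hs : 0 < c * (Real.log L / L) := by positivity
  refine dimH_Iq_le_of_rpow_le hq hs ?_
  rw [← Real.log_le_log_iff (Real.rpow_pos_of_pos (by linarith) _) hs,
    Real.log_rpow (by linarith), log_mul_div_eq (by linarith) (by linarith) (by linarith)]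
  have hlq : L - Real.log 2 ≤ Real.log (q - 1) := by
    rw [← Real.log_div (by positivity) (by norm_num)]
    exact Real.log_le_log (by positivity) (by linarith)
  rw [div_le_iff₀ (by linarith)] at hLc
  have h1 : Real.log L ≤ c * (Real.log L / L) * (L - Real.log 2) := by
    rw [mul_div_assoc', div_mul_eq_mul_div, le_div_iff₀ (by linarith)]
    nlinarith
  have h2 := mul_le_mul_of_nonneg_left hlq hs.le
  have h3 := Real.log_pos hc
  have h4 := Real.log_nonneg hl
  linarith

lemma eventually_le_dimH_Iq {c : ℝ} (hc0 : 0 < c) (hc : c < 1) : ∀ᶠ q : ℕ in atTop,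
    ENNReal.ofReal ((1 + c * (Real.log (Real.log q) / Real.log q)) / 2) ≤ dimH (Iq q) := by
  have hlog2 := Real.log_pos one_lt_two
  have hlittle := tendsto_log_log_natCast.eventually
    (Real.isLittleO_log_id_atTop.bound (by linarith : 0 < (1 - c) / 4))
  filter_upwards [eventually_ge_atTop 2, tendsto_log_natCast.eventually_ge_atTop 1,
    tendsto_log_natCast.eventually_ge_atTop (c * Real.log 2 / ((1 - c) / 2)),
    tendsto_log_log_natCast.eventually_ge_atTop 1, hlittle] with q hq hL hLc hl hll
  have hq' : (2 : ℝ) ≤ q := by exact_mod_cast hq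
  set L := Real.log q
  have hs : 0 < c * (Real.log L / L) := by positivity
  refine le_dimH_Iq_of_lt_rpow hq hs ?_
  rw [← Real.log_lt_log_iff hs (by positivity), Real.log_rpow (by positivity),
    log_mul_div_eq hc0 (by linarith) (by linarith)]
  have hlq : Real.log (q + 1) ≤ L + Real.log 2 := by
    rw [← Real.log_mul (by positivity) (by norm_num)]
    exact Real.log_le_log (by positivity) (by linarith)
  rw [div_le_iff₀ (by linarith)] at hLc
  have h1 : c * (Real.log L / L) * (L + Real.log 2) ≤ (1 + c) / 2 * Real.log L := by
    rw [mul_div_assoc', div_mul_eq_mul_div, div_le_iff₀ (by linarith)]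
    nlinarith
  have h2 := mul_le_mul_of_nonneg_left hlq hs.le
  have h3 := Real.log_neg hc0 hc
  have h4 : Real.log (Real.log L) ≤ (1 - c) / 4 * Real.log L := by
    rw [id, Real.norm_of_nonneg (by linarith : 0 ≤ Real.log L)] at hll
    exact (le_abs_self _).trans hll
  nlinarith

/-- Precise asymptotic: `dim_H(𝓘_q) − 1/2 ∼ (1/2) (log log q)/(log q)` as `q → ∞`. -/
theorem dimH_Iq_asymptotic :
    Tendsto (fun q : ℕ =>
        ((dimH (Iq q)).toReal - 1 / 2) / (1 / 2 * (Real.log (Real.log q) / Real.log q)))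
      atTop (nhds 1) := by
  have hpos : ∀ᶠ q : ℕ in atTop, 0 < Real.log (Real.log q) / Real.log q := by
    filter_upwards [tendsto_log_natCast.eventually_gt_atTop 0,
      tendsto_log_log_natCast.eventually_gt_atTop 0] with q h1 h2 using div_pos h2 h1
  refine tendsto_order.2 ⟨fun b hb => ?_, fun b hb => ?_⟩
  · obtain ⟨c, hbc, hc1⟩ := exists_between (max_lt hb one_pos)
    filter_upwards [hpos, eventually_le_dimH_Iq ((le_max_right _ _).trans_lt hbc) hc1]
      with q hr hd
    have hd' := (ENNReal.ofReal_le_iff_le_toReal (Real.dimH_ne_top _)).1 hd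
    rw [lt_div_iff₀ (by linarith)]
    have := mul_lt_mul_of_pos_right ((le_max_left b 0).trans_lt hbc) hr
    linarith
  · obtain ⟨c, hc1, hcb⟩ := exists_between hb
    filter_upwards [hpos, eventually_dimH_Iq_le hc1] with q hr hd
    have hd' := ENNReal.toReal_le_of_le_ofReal (by nlinarith) hd
    rw [div_lt_iff₀ (by linarith)]
    have := mul_lt_mul_of_pos_right hcb hr
    linarith
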